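/- Let d ≥ 3, h(x) = |x|^{2−d}, and let K ⊂ ℝ^d be a centrally symmetric convex body normalized so that ∫_K x_i x_j dx = δ_{ij}. If Σ_{1≤i,j,k,ℓ≤d} ∂_{ijkℓ}h(3,0,…,0) ∫_K y_i y_j y_k y_ℓ dy ≠ 0, then there exists z ∈ S^{d−1} such that Mh(3z) > 3^{2−d} = h(3z). -/

import Mathlib

open MeasureTheory Metric

/-- The centered maximal function on `ℝ^d` associated to a centrally symmetric
convex body `K`. -/
noncomputable def centeredMax {d : ℕ} (K : Set (EuclideanSpace ℝ (Fin d)))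
    (f : EuclideanSpace ℝ (Fin d) → ℝ) (x : EuclideanSpace ℝ (Fin d)) : ℝ :=
  ⨆ l : {l : ℝ // 0 < l}, ⨍ y in (fun z => x + (l : ℝ) • z) '' K, |f y|

lemma mb_binom (p : ℝ) : ∃ C > 0, ∃ δ > 0, ∀ s : ℝ, |s| < δ →
    |(1 + s) ^ p - (1 + p * s + p * (p - 1) / 2 * s ^ 2 + p * (p - 1) * (p - 2) / 6 * s ^ 3
      + p * (p - 1) * (p - 2) * (p - 3) / 24 * s ^ 4)| ≤ C * |s| ^ 5 := by
  have h := (Real.one_add_rpow_hasFPowerSeriesAt_zero (a := p)).isBigO_sub_partialSum_pow 5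
  obtain ⟨C, hC, hb⟩ := h.exists_pos
  rw [Asymptotics.IsBigOWith] at hb
  obtain ⟨δ, hδ, hball⟩ := Metric.eventually_nhds_iff.1 hb
  refine ⟨C, hC, δ, hδ, fun s hs => ?_⟩
  have := hball (y := s) (by simpa using hs)
  simp only [zero_add, FormalMultilinearSeries.partialSum, binomialSeries_apply,
    Finset.sum_range_succ, Finset.sum_range_zero] at this
  have e2 : Ring.choose p 2 = p * (p - 1) / 2 := by
    rw [Ring.choose_eq_smul]
    rw [← Polynomial.aeval_eq_smeval]; simp [descPochhammer, Nat.factorial]; ring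
  have e3 : Ring.choose p 3 = p * (p - 1) * (p - 2) / 6 := by
    rw [Ring.choose_eq_smul]
    rw [← Polynomial.aeval_eq_smeval]; simp [descPochhammer, Nat.factorial]; ring
  have e4 : Ring.choose p 4 = p * (p - 1) * (p - 2) * (p - 3) / 24 := by
    rw [Ring.choose_eq_smul]
    rw [← Polynomial.aeval_eq_smeval]; simp [descPochhammer, Nat.factorial]; ring
  simp [e2, e3, e4] at this
  refine le_trans (le_of_eq ?_) this
  congr 1
  ring

lemma mb_expand (p R : ℝ) : ∃ C > 0, ∃ δ > 0, ∀ a b t : ℝ, |a| ≤ R → |b| ≤ R →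
    0 < t → t < δ →
    |(9 + 2 * b * t + a * t ^ 2) ^ p - (9 : ℝ) ^ p * (1 + (p * (2 * b) / 9) * t +
      (p * a / 9 + p * (p - 1) / 2 * (4 * b ^ 2) / 81) * t ^ 2 +
      (p * (p - 1) / 2 * (4 * a * b) / 81 + p * (p - 1) * (p - 2) / 6 * (8 * b ^ 3) / 729) * t ^ 3 +
      (p * (p - 1) / 2 * a ^ 2 / 81 + p * (p - 1) * (p - 2) / 6 * (12 * a * b ^ 2) / 729 +
       p * (p - 1) * (p - 2) * (p - 3) / 24 * (16 * b ^ 4) / 6561) * t ^ 4)| ≤ C * t ^ 5 := by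
  obtain ⟨C, hC, δ, hδ, H⟩ := mb_binom p
  let Q : ℝ × ℝ × ℝ → ℝ := fun q =>
    p * (p - 1) * (p - 2) / 6 * (6 * q.1 ^ 2 * q.2.1 + q.1 ^ 3 * q.2.2) / 729 +
    p * (p - 1) * (p - 2) * (p - 3) / 24 * (32 * q.1 * q.2.1 ^ 3 + 24 * q.1 ^ 2 * q.2.1 ^ 2 * q.2.2
      + 8 * q.1 ^ 3 * q.2.1 * q.2.2 ^ 2 + q.1 ^ 4 * q.2.2 ^ 3) / 6561
  have hQ : Continuous Q := by fun_prop
  obtain ⟨M, hM⟩ := ((isCompact_Icc (a := -R) (b := R)).prod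
    ((isCompact_Icc (a := -R) (b := R)).prod (isCompact_Icc (a := (0:ℝ)) (b := 1)))).exists_bound_of_continuousOn
    hQ.continuousOn
  set L := |R| + 1 with hL
  have hLpos : 0 < L := by positivity
  refine ⟨(9 : ℝ) ^ p * (C * L ^ 5 + |M|), by positivity, min 1 (min δ 1 / L), by positivity,
    fun a b t ha hb ht htd => ?_⟩
  have ht1 : t < 1 := lt_of_lt_of_le htd (min_le_left _ _)
  have htL0 : t * L < min δ 1 := by
    have := lt_of_lt_of_le htd (min_le_right _ _)
    rwa [lt_div_iff₀ hLpos] at this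
  have htL : t * L < δ := lt_of_lt_of_le htL0 (min_le_left _ _)
  have htL1 : t * L < 1 := lt_of_lt_of_le htL0 (min_le_right _ _)
  have hR : R ≤ |R| := le_abs_self R
  have ha' := abs_le.1 ha
  have hb' := abs_le.1 hb
  set s := (2 * b * t + a * t ^ 2) / 9 with hs
  have hsL : |s| ≤ t * L := by
    rw [hs, show (2 * b * t + a * t ^ 2) / 9 = t * ((2 * b + a * t) / 9) by ring, abs_mul,
      abs_of_pos ht]
    apply mul_le_mul_of_nonneg_left _ ht.le
    have h1 : |a * t| ≤ |R| := by
      rw [abs_mul, abs_of_pos ht]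
      nlinarith [abs_nonneg a]
    have h2 := abs_le.1 h1
    have := abs_nonneg R
    rw [abs_le]; constructor <;> linarith
  have hs1 : 0 ≤ 1 + s := by
    have := (abs_le.1 hsL).1
    linarith
  have key := H s (lt_of_le_of_lt hsL htL)
  have e1 : (9 + 2 * b * t + a * t ^ 2) ^ p = (9:ℝ) ^ p * (1 + s) ^ p := by
    rw [← Real.mul_rpow (by norm_num) hs1]; congr 1; rw [hs]; ring
  have hm := hM (a, b, t) ⟨⟨ha'.1, ha'.2⟩, ⟨hb'.1, hb'.2⟩, ht.le, ht1.le⟩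
  rw [e1, ← mul_sub, abs_mul, abs_of_pos (by positivity), mul_assoc ((9:ℝ) ^ p)]
  apply mul_le_mul_of_nonneg_left _ (by positivity)
  have e3 : |s| ^ 5 ≤ (t * L) ^ 5 := by gcongr
  have e4 : |t ^ 5 * Q (a, b, t)| ≤ t ^ 5 * |M| := by
    rw [abs_mul, abs_of_pos (show 0 < t ^ 5 by positivity)]
    exact mul_le_mul_of_nonneg_left (hm.trans (le_abs_self M)) (by positivity)
  refine le_trans (b := C * |s| ^ 5 + |t ^ 5 * Q (a, b, t)|) ?_ ?_
  · refine le_trans (le_of_eq ?_) ((abs_add_le _ _).trans (add_le_add_left key _))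
    congr 1
    simp only [Q, hs]
    ring
  · nlinarith [mul_le_mul_of_nonneg_left e3 hC.le]

lemma mb_image {d : ℕ} (K : Set (EuclideanSpace ℝ (Fin d))) (hK : MeasurableSet K)
    (f : EuclideanSpace ℝ (Fin d) → ℝ) (x : EuclideanSpace ℝ (Fin d)) (l : ℝ) (hl : 0 < l) :
    ∫ y in (fun z => x + l • z) '' K, f y = l ^ d * ∫ y in K, f (x + l • y) := by
  have hdet : (l • ContinuousLinearMap.id ℝ (EuclideanSpace ℝ (Fin d))).det = l ^ d := by
    rw [ContinuousLinearMap.det]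
    simp
  have := integral_image_eq_integral_abs_det_fderiv_smul (volume : Measure (EuclideanSpace ℝ (Fin d)))
    (s := K) (f := fun z => x + l • z) (f' := fun _ => l • ContinuousLinearMap.id ℝ _) hK
    (fun z _ => (((hasFDerivAt_id z).const_smul l).const_add x).hasFDerivWithinAt)
    (by
      intro a _ b _ hab
      simpa [hl.ne'] using hab) f
  rw [this, hdet, abs_of_pos (by positivity)]
  simp only [smul_eq_mul]
  rw [integral_const_mul]

lemma mb_vol {d : ℕ} (K : Set (EuclideanSpace ℝ (Fin d))) (hK : MeasurableSet K)
    (x : EuclideanSpace ℝ (Fin d)) (l : ℝ) (hl : 0 < l) :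
    volume.real ((fun z => x + l • z) '' K) = l ^ d * volume.real K := by
  have := mb_image K hK (fun _ => (1:ℝ)) x l hl
  simpa using this

lemma mb_avg {d : ℕ} (K : Set (EuclideanSpace ℝ (Fin d))) (hK : MeasurableSet K)
    (f : EuclideanSpace ℝ (Fin d) → ℝ) (x : EuclideanSpace ℝ (Fin d)) (l : ℝ) (hl : 0 < l) :
    ⨍ y in (fun z => x + l • z) '' K, f y = (volume.real K)⁻¹ * ∫ y in K, f (x + l • y) := by
  rw [setAverage_eq, mb_image K hK f x l hl, mb_vol K hK x l hl, smul_eq_mul]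
  have : l ^ d ≠ 0 := by positivity
  field_simp

lemma mb_int (d : ℕ) (hd : 3 ≤ d) :
    IntegrableOn (fun x : EuclideanSpace ℝ (Fin d) => ‖x‖ ^ ((2 : ℝ) - d)) (ball 0 1) := by
  have : Nontrivial (EuclideanSpace ℝ (Fin d)) := by
    have : Nonempty (Fin d) := ⟨⟨0, by omega⟩⟩
    infer_instance
  rw [← integrable_indicator_iff measurableSet_ball]
  have : (ball (0 : EuclideanSpace ℝ (Fin d)) 1).indicator
      (fun x : EuclideanSpace ℝ (Fin d) => ‖x‖ ^ ((2 : ℝ) - d)) =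
      fun x => (Set.Iio (1:ℝ)).indicator (fun r : ℝ => r ^ ((2 : ℝ) - d)) ‖x‖ := by
    ext x
    simp [Set.indicator]
  rw [this, integrable_fun_norm_addHaar]
  have h1 : IntegrableOn (fun y : ℝ => (1:ℝ)) (Set.Ioo 0 1) := by simp
  have h2 : IntegrableOn ((Set.Ioo (0:ℝ) 1).indicator (fun y : ℝ => y)) (Set.Ioi 0) := by
    apply Integrable.integrableOn
    rw [integrable_indicator_iff measurableSet_Ioo]
    exact (continuous_id.integrableOn_Icc (a := 0) (b := 1)).mono_set Set.Ioo_subset_Icc_self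
  refine h2.congr_fun ?_ measurableSet_Ioi
  intro y hy
  simp only [Set.indicator, Set.mem_Ioo, Set.mem_Iio, smul_eq_mul]
  have hy0 : (0:ℝ) < y := hy
  by_cases hy1 : y < 1
  · simp only [hy0, hy1, and_self, if_true, finrank_euclideanSpace, Fintype.card_fin]
    rw [← Real.rpow_natCast, ← Real.rpow_add hy0]
    have : ((d - 1 : ℕ) : ℝ) + (2 - d) = 1 := by
      rw [Nat.cast_sub (by omega)]; push_cast; ring
    rw [this, Real.rpow_one]
  · simp [hy1]

set_option maxHeartbeats 1000000 in
lemma mb_bdd (d : ℕ) (hd : 3 ≤ d) (K : Set (EuclideanSpace ℝ (Fin d))) (hK : IsCompact K)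
    (hV : 0 < volume.real K)
    (x : EuclideanSpace ℝ (Fin d)) (hx : ‖x‖ = 3) :
    BddAbove (Set.range fun l : {l : ℝ // 0 < l} =>
      ⨍ y in (fun z => x + (l : ℝ) • z) '' K, |‖y‖ ^ ((2 : ℝ) - d)|) := by
  set C0 := ∫ y in ball (0 : EuclideanSpace ℝ (Fin d)) 1, ‖y‖ ^ ((2 : ℝ) - d) with hC0
  have hC0n : 0 ≤ C0 := by
    apply integral_nonneg; intro y; positivity
  obtain ⟨R, hR0, hR⟩ := hK.isBounded.exists_pos_norm_le
  have hp : (2:ℝ) - d ≤ 0 := by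
    have : (3:ℝ) ≤ d := by exact_mod_cast hd
    linarith
  have hle1 : ∀ y : EuclideanSpace ℝ (Fin d), 1 ≤ ‖y‖ → ‖y‖ ^ ((2 : ℝ) - d) ≤ 1 := fun y hy =>
    Real.rpow_le_one_of_one_le_of_nonpos hy hp
  refine ⟨1 + C0 / ((2 / R) ^ d * volume.real K), ?_⟩
  rintro _ ⟨⟨l, hl⟩, rfl⟩
  simp only
  set S := (fun z => x + l • z) '' K with hS
  have hSc : IsCompact S := hK.image (by fun_prop)
  have hSv : volume.real S = l ^ d * volume.real K := mb_vol K hK.measurableSet x l hl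
  have hSpos : 0 < volume.real S := by rw [hSv]; positivity
  have habs : ∀ y : EuclideanSpace ℝ (Fin d), |‖y‖ ^ ((2 : ℝ) - d)| = ‖y‖ ^ ((2 : ℝ) - d) :=
    fun y => abs_of_nonneg (by positivity)
  simp only [habs]
  have hfin : volume S ≠ ⊤ := hSc.measure_lt_top.ne
  have hout : IntegrableOn (fun y : EuclideanSpace ℝ (Fin d) => ‖y‖ ^ ((2 : ℝ) - d)) (S \ ball 0 1) := by
    refine Measure.integrableOn_of_bounded (M := 1) (ne_top_of_le_ne_top hfin (measure_mono Set.sdiff_subset)) ?_ ?_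
    · exact (measurable_norm.pow_const _).aestronglyMeasurable
    · refine (ae_restrict_iff' (hSc.measurableSet.diff measurableSet_ball)).2 (Filter.Eventually.of_forall ?_)
      intro y hy
      rw [Real.norm_eq_abs, habs]
      apply hle1
      simpa using hy.2
  have hout_le : ∫ y in S \ ball 0 1, ‖y‖ ^ ((2 : ℝ) - d) ≤ volume.real S := by
    calc ∫ y in S \ ball 0 1, ‖y‖ ^ ((2 : ℝ) - d) ≤ ∫ y in S \ ball 0 1, (1:ℝ) := by
          apply setIntegral_mono_on hout _ (hSc.measurableSet.diff measurableSet_ball)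
          · intro y hy
            apply hle1
            simpa using hy.2
          · exact integrableOn_const (ne_top_of_le_ne_top hfin (measure_mono Set.sdiff_subset))
      _ = volume.real (S \ ball 0 1) := by simp
      _ ≤ volume.real S := measureReal_mono Set.sdiff_subset hfin
  have hin : IntegrableOn (fun y : EuclideanSpace ℝ (Fin d) => ‖y‖ ^ ((2 : ℝ) - d)) (S ∩ ball 0 1) :=
    (mb_int d hd).mono_set Set.inter_subset_right
  have hsplit : ∫ y in S, ‖y‖ ^ ((2 : ℝ) - d) = (∫ y in S ∩ ball 0 1, ‖y‖ ^ ((2 : ℝ) - d)) +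
      ∫ y in S \ ball 0 1, ‖y‖ ^ ((2 : ℝ) - d) := by
    rw [integral_inter_add_sdiff measurableSet_ball]
    have := hin.union hout
    rwa [Set.inter_union_sdiff] at this
  rw [setAverage_eq, smul_eq_mul, inv_mul_le_iff₀ hSpos, hsplit]
  have hin_le : ∫ y in S ∩ ball 0 1, ‖y‖ ^ ((2 : ℝ) - d) ≤
      volume.real S * (C0 / ((2 / R) ^ d * volume.real K)) := by
    by_cases hlR : l * R < 2
    · have : S ∩ ball 0 1 = ∅ := by
        rw [Set.eq_empty_iff_forall_notMem]
        rintro _ ⟨⟨y, hy, rfl⟩, hb⟩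
        have h1 : ‖x + l • y‖ < 1 := by simpa using hb
        have h2 : ‖l • y‖ ≤ l * R := by
          rw [norm_smul, Real.norm_of_nonneg hl.le]
          exact mul_le_mul_of_nonneg_left (hR y hy) hl.le
        have h3 : ‖x‖ ≤ ‖x + l • y‖ + ‖l • y‖ := by
          simpa using norm_sub_le (x + l • y) (l • y)
        linarith
      rw [this]
      simp only [Measure.restrict_empty, integral_zero_measure]
      exact mul_nonneg hSpos.le (div_nonneg hC0n (mul_nonneg (by positivity) hV.le))
    · push Not at hlR
      have h1 : ∫ y in S ∩ ball 0 1, ‖y‖ ^ ((2 : ℝ) - d) ≤ C0 := by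
        apply setIntegral_mono_set (mb_int d hd)
        · exact Filter.Eventually.of_forall fun y => by positivity
        · exact Filter.Eventually.of_forall fun y hy => hy.2
      refine h1.trans ?_
      have h2 : (2 / R) ^ d * volume.real K ≤ volume.real S := by
        rw [hSv]
        gcongr
        rw [div_le_iff₀ hR0]; exact hlR
      have h3 : 0 < (2 / R) ^ d * volume.real K := mul_pos (by positivity) hV
      rw [mul_div_assoc', le_div_iff₀ h3, mul_comm]
      exact mul_le_mul_of_nonneg_right h2 hC0n
  rw [mul_add, mul_one, add_comm]
  exact add_le_add hout_le hin_le

lemma mb_rot {d : ℕ} (G : ℝ → ℝ → ℝ) (y y' : EuclideanSpace ℝ (Fin d)) (hy : ‖y‖ = ‖y'‖) :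
    ∫ x in ball (0 : EuclideanSpace ℝ (Fin d)) 1, G ‖x‖ (inner ℝ x y) =
      ∫ x in ball (0 : EuclideanSpace ℝ (Fin d)) 1, G ‖x‖ (inner ℝ x y') := by
  set U := (ℝ ∙ (y - y'))ᗮ.reflection with hU
  have hUy : U y = y' := Submodule.reflection_sub hy
  have h := (U.measurePreserving).setIntegral_preimage_emb U.toMeasurableEquiv.measurableEmbedding
    (fun x => G ‖x‖ (inner ℝ x y')) (ball 0 1)
  have hb : U ⁻¹' ball 0 1 = ball 0 1 := by
    ext x; simp
  rw [hb] at h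
  rw [← h]
  congr 1
  ext x
  rw [← hUy, U.inner_map_map, U.norm_map]

lemma mb_J4 {d : ℕ} (i : Fin d) (y : EuclideanSpace ℝ (Fin d)) :
    ∫ x in ball (0 : EuclideanSpace ℝ (Fin d)) 1, (inner ℝ x y) ^ 4 =
      ‖y‖ ^ 4 * ∫ x in ball (0 : EuclideanSpace ℝ (Fin d)) 1, (x i) ^ 4 := by
  rw [mb_rot (fun _ b => b ^ 4) y (EuclideanSpace.single i ‖y‖) (by simp), ← integral_const_mul]
  congr 1
  ext x
  simp [EuclideanSpace.inner_single_right]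
  ring

lemma mb_J2 {d : ℕ} (i : Fin d) (y : EuclideanSpace ℝ (Fin d)) :
    ∫ x in ball (0 : EuclideanSpace ℝ (Fin d)) 1, ‖x‖ ^ 2 * (inner ℝ x y) ^ 2 =
      ‖y‖ ^ 2 * ∫ x in ball (0 : EuclideanSpace ℝ (Fin d)) 1, ‖x‖ ^ 2 * (x i) ^ 2 := by
  rw [mb_rot (fun a b => a ^ 2 * b ^ 2) y (EuclideanSpace.single i ‖y‖) (by simp),
    ← integral_const_mul]
  congr 1
  ext x
  simp [EuclideanSpace.inner_single_right]
  ring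

lemma mb_ballInt {d : ℕ} (f : EuclideanSpace ℝ (Fin d) → ℝ) (hf : Continuous f) :
    IntegrableOn f (ball 0 1) :=
  (hf.continuousOn.integrableOn_compact (isCompact_closedBall 0 1)).mono_set ball_subset_closedBall

lemma mb_moments (d : ℕ) (i : Fin d) :
    (∫ x in ball (0 : EuclideanSpace ℝ (Fin d)) 1, ‖x‖ ^ 4 =
      d * ∫ x in ball (0 : EuclideanSpace ℝ (Fin d)) 1, ‖x‖ ^ 2 * (x i) ^ 2) ∧
    (∫ x in ball (0 : EuclideanSpace ℝ (Fin d)) 1, ‖x‖ ^ 2 * (x i) ^ 2 =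
      (d + 2) / 3 * ∫ x in ball (0 : EuclideanSpace ℝ (Fin d)) 1, (x i) ^ 4) := by
  constructor
  · have h1 : ∀ x : EuclideanSpace ℝ (Fin d), ‖x‖ ^ 4 = ∑ j, ‖x‖ ^ 2 * (x j) ^ 2 := by
      intro x
      rw [← Finset.mul_sum, ← EuclideanSpace.real_norm_sq_eq]; ring
    simp_rw [h1]
    rw [integral_finsetSum _ (fun j _ => mb_ballInt _ (by fun_prop))]
    have h2 : ∀ j : Fin d, ∫ x in ball (0 : EuclideanSpace ℝ (Fin d)) 1, ‖x‖ ^ 2 * (x j) ^ 2 =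
        ∫ x in ball (0 : EuclideanSpace ℝ (Fin d)) 1, ‖x‖ ^ 2 * (x i) ^ 2 := by
      intro j
      have := mb_J2 i (EuclideanSpace.single j (1:ℝ))
      simpa [EuclideanSpace.inner_single_right] using this
    simp [h2]
  · have h1 : ∀ x : EuclideanSpace ℝ (Fin d), ‖x‖ ^ 2 * (x i) ^ 2 = ∑ j, (x j) ^ 2 * (x i) ^ 2 := by
      intro x
      rw [← Finset.sum_mul, ← EuclideanSpace.real_norm_sq_eq]
    simp_rw [h1]
    rw [integral_finsetSum _ (fun j _ => mb_ballInt _ (by fun_prop))]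
    set A := ∫ x in ball (0 : EuclideanSpace ℝ (Fin d)) 1, (x i) ^ 4 with hA
    have h2 : ∀ j : Fin d, ∫ x in ball (0 : EuclideanSpace ℝ (Fin d)) 1, (x j) ^ 2 * (x i) ^ 2 =
        A / 3 + if j = i then 2 / 3 * A else 0 := by
      intro j
      by_cases hji : j = i
      · subst hji
        simp only [if_true]
        rw [show A / 3 + 2 / 3 * A = A by ring, hA]
        congr 1; ext x; ring
      · simp only [hji, if_false, add_zero]
        have hij : i ≠ j := fun h => hji h.symm
        have n1 : ‖(EuclideanSpace.single i (1:ℝ) + EuclideanSpace.single j 1 : EuclideanSpace ℝ (Fin d))‖ ^ 2 = 2 := by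
          rw [norm_add_sq_real]
          simp [EuclideanSpace.inner_single_right, hji]; norm_num
        have n2 : ‖(EuclideanSpace.single i (1:ℝ) - EuclideanSpace.single j 1 : EuclideanSpace ℝ (Fin d))‖ ^ 2 = 2 := by
          rw [norm_sub_sq_real]
          simp [EuclideanSpace.inner_single_right, hji]; norm_num
        have e1 := mb_J4 i (EuclideanSpace.single i (1:ℝ) + EuclideanSpace.single j 1)
        have e2 := mb_J4 i (EuclideanSpace.single i (1:ℝ) - EuclideanSpace.single j 1)
        have e3 := mb_J4 i (EuclideanSpace.single j (1:ℝ))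
        have k1 : ‖(EuclideanSpace.single i (1:ℝ) + EuclideanSpace.single j 1 : EuclideanSpace ℝ (Fin d))‖ ^ 4 = 4 := by
          rw [show (4:ℕ) = 2 * 2 from rfl, pow_mul, n1]; norm_num
        have k2 : ‖(EuclideanSpace.single i (1:ℝ) - EuclideanSpace.single j 1 : EuclideanSpace ℝ (Fin d))‖ ^ 4 = 4 := by
          rw [show (4:ℕ) = 2 * 2 from rfl, pow_mul, n2]; norm_num
        rw [k1, ← hA] at e1
        rw [k2, ← hA] at e2
        rw [← hA] at e3
        simp only [inner_add_right, inner_sub_right, EuclideanSpace.inner_single_right,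
          conj_trivial, one_mul, PiLp.norm_single, norm_one, one_pow] at e1 e2 e3
        have e4 : (∫ x in ball (0 : EuclideanSpace ℝ (Fin d)) 1, (x i + x j) ^ 4) +
            (∫ x in ball (0 : EuclideanSpace ℝ (Fin d)) 1, (x i - x j) ^ 4) =
            2 * (∫ x in ball (0 : EuclideanSpace ℝ (Fin d)) 1, (x i) ^ 4) +
            2 * (∫ x in ball (0 : EuclideanSpace ℝ (Fin d)) 1, (x j) ^ 4) +
            12 * (∫ x in ball (0 : EuclideanSpace ℝ (Fin d)) 1, (x j) ^ 2 * (x i) ^ 2) := by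
          rw [← integral_const_mul, ← integral_const_mul, ← integral_const_mul,
            ← integral_add (mb_ballInt _ (by fun_prop)) (mb_ballInt _ (by fun_prop)),
            ← integral_add (mb_ballInt _ (by fun_prop)) (mb_ballInt _ (by fun_prop)),
            ← integral_add (mb_ballInt _ (by fun_prop)) (mb_ballInt _ (by fun_prop))]
          congr 1; ext x; ring
        rw [e1, e2, e3, ← hA] at e4
        linarith
    simp_rw [h2]
    rw [Finset.sum_add_distrib]
    simp
    ring

/-- The quartic polynomial kernel. -/
noncomputable def mbq {d : ℕ} (x y : EuclideanSpace ℝ (Fin d)) : ℝ :=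
  3 * ‖x‖ ^ 4 * ‖y‖ ^ 4 - 6 * (d + 2) * ‖x‖ ^ 2 * ‖y‖ ^ 2 * (inner ℝ x y) ^ 2
    + (d + 2) * (d + 4) * (inner ℝ x y) ^ 4

lemma mbq_cont {d : ℕ} : Continuous (fun z : EuclideanSpace ℝ (Fin d) × EuclideanSpace ℝ (Fin d) =>
    mbq z.1 z.2) := by
  unfold mbq; fun_prop

lemma mbq_int {d : ℕ} (i : Fin d) (y : EuclideanSpace ℝ (Fin d)) :
    ∫ x in ball (0 : EuclideanSpace ℝ (Fin d)) 1, mbq x y = 0 := by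
  have e : ∀ x : EuclideanSpace ℝ (Fin d), mbq x y = 3 * ‖y‖ ^ 4 * ‖x‖ ^ 4 +
    (- 6 * (d + 2) * ‖y‖ ^ 2) * (‖x‖ ^ 2 * (inner ℝ x y) ^ 2)
    + (d + 2) * (d + 4) * (inner ℝ x y) ^ 4 := by intro x; unfold mbq; ring
  simp_rw [e]
  rw [integral_add (mb_ballInt _ (by fun_prop)) (mb_ballInt _ (by fun_prop)),
    integral_add (mb_ballInt _ (by fun_prop)) (mb_ballInt _ (by fun_prop)),
    integral_const_mul, integral_const_mul, integral_const_mul, mb_J4 i, mb_J2 i,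
    (mb_moments d i).1, (mb_moments d i).2]
  ring

lemma mbQ_exists {d : ℕ} (i : Fin d) (K : Set (EuclideanSpace ℝ (Fin d))) (hK : IsCompact K)
    (x0 : EuclideanSpace ℝ (Fin d)) (hx0 : ‖x0‖ = 3) (hne : ∫ y in K, mbq x0 y ≠ 0) :
    ∃ z : EuclideanSpace ℝ (Fin d), ‖z‖ = 1 ∧ 0 < ∫ y in K, mbq ((3:ℝ) • z) y := by
  by_contra hcon
  push Not at hcon
  set Q : EuclideanSpace ℝ (Fin d) → ℝ := fun x => ∫ y in K, mbq x y with hQ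
  have hhom : ∀ (c : ℝ) (x : EuclideanSpace ℝ (Fin d)), Q (c • x) = c ^ 4 * Q x := by
    intro c x
    simp only [hQ]
    rw [← integral_const_mul]
    congr 1; ext y
    unfold mbq
    rw [norm_smul, real_inner_smul_left, mul_pow, mul_pow, Real.norm_eq_abs,
      sq_abs, show |c| ^ 4 = c ^ 4 from (by norm_num : Even 4).pow_abs c]
    ring
  have hneg : ∀ x, Q x ≤ 0 := by
    intro x
    by_cases hx : x = 0
    · have := hhom 0 0
      rw [zero_smul] at this
      rw [hx, this]; simp
    · have hn : 0 < ‖x‖ := norm_pos_iff.2 hx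
      have h1 := hcon (‖x‖⁻¹ • x) (by rw [norm_smul, norm_inv, norm_norm]; field_simp)
      have h2 : x = (‖x‖ / 3) • ((3:ℝ) • (‖x‖⁻¹ • x)) := by
        rw [smul_smul, smul_smul]
        rw [show ‖x‖ / 3 * 3 * ‖x‖⁻¹ = 1 by field_simp, one_smul]
      rw [h2, hhom]
      exact mul_nonpos_of_nonneg_of_nonpos (by positivity) h1
  have hcont : Continuous Q := continuous_parametric_integral_of_continuous mbq_cont hK
  have hzero : ∫ x in ball (0 : EuclideanSpace ℝ (Fin d)) 1, Q x = 0 := by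
    simp only [hQ]
    rw [integral_integral_swap]
    · simp [mbq_int i]
    · rw [Measure.prod_restrict]
      exact (mbq_cont.continuousOn.integrableOn_compact
        ((isCompact_closedBall (0 : EuclideanSpace ℝ (Fin d)) 1).prod hK)).mono_set
          (Set.prod_mono ball_subset_closedBall subset_rfl)
  have hae : (fun x => - Q x) =ᵐ[volume.restrict (ball (0 : EuclideanSpace ℝ (Fin d)) 1)] 0 := by
    rw [← setIntegral_eq_zero_iff_of_nonneg_ae]
    · rw [integral_neg, hzero, neg_zero]
    · exact Filter.Eventually.of_forall fun x => by simpa using hneg x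
    · exact mb_ballInt _ hcont.neg
  have heq := Measure.eqOn_open_of_ae_eq hae isOpen_ball hcont.neg.continuousOn continuousOn_const
  have h0 := heq (x := (1/4 : ℝ) • x0) (by simp [norm_smul, hx0]; norm_num)
  simp only [hhom, Pi.zero_apply, neg_eq_zero] at h0
  apply hne
  simpa using h0

lemma mb_normpow (d : ℕ) (x y : EuclideanSpace ℝ (Fin d)) (hx : ‖x‖ = 3) (t : ℝ) :
    ‖x + t • y‖ ^ ((2 : ℝ) - d) = (9 + 2 * inner ℝ x y * t + ‖y‖ ^ 2 * t ^ 2) ^ (((2:ℝ) - d) / 2) := by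
  have : 9 + 2 * inner ℝ x y * t + ‖y‖ ^ 2 * t ^ 2 = ‖x + t • y‖ ^ 2 := by
    rw [norm_add_sq_real, norm_smul, real_inner_smul_right, hx, mul_pow, Real.norm_eq_abs, sq_abs]
    ring
  rw [this, ← Real.rpow_natCast, ← Real.rpow_mul (norm_nonneg _)]
  congr 1
  push_cast; ring

lemma mb_iter_step (U : Set ℝ) (hU : IsOpen U) (f g g' : ℝ → ℝ) (n : ℕ)
    (h : ∀ t ∈ U, iteratedDeriv n f t = g t) (hg : ∀ t ∈ U, HasDerivAt g (g' t) t) :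
    ∀ t ∈ U, iteratedDeriv (n + 1) f t = g' t := by
  intro t ht
  rw [iteratedDeriv_succ]
  have : iteratedDeriv n f =ᶠ[nhds t] g := by
    filter_upwards [hU.mem_nhds ht] with s hs using h s hs
  rw [this.deriv_eq, (hg t ht).deriv]

lemma mb_iter4 (p a b : ℝ) : iteratedDeriv 4 (fun t : ℝ => (9 + 2 * b * t + a * t ^ 2) ^ p) 0 =
    24 * (9 : ℝ) ^ p * (p * (p - 1) / 2 * a ^ 2 / 81 + p * (p - 1) * (p - 2) / 6 * (12 * a * b ^ 2) / 729 +
       p * (p - 1) * (p - 2) * (p - 3) / 24 * (16 * b ^ 4) / 6561) := by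
  let u : ℝ → ℝ := fun t => 9 + 2 * b * t + a * t ^ 2
  let v : ℝ → ℝ := fun t => 2 * b + 2 * a * t
  let U : Set ℝ := {t | 0 < u t}
  have hU : IsOpen U := isOpen_lt continuous_const (by fun_prop)
  have hu : ∀ t, HasDerivAt u (v t) t := by
    intro t
    have h1 := (((hasDerivAt_id t).const_mul (2 * b)).const_add 9).add (((hasDerivAt_id t).pow 2).const_mul a)
    exact h1.congr_deriv (by simp [v]; ring)
  have hv : ∀ t, HasDerivAt v (2 * a) t := by
    intro t
    have h1 := (((hasDerivAt_id t).const_mul (2 * a)).const_add (2 * b))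
    exact h1.congr_deriv (by simp)
  have hw : ∀ q : ℝ, ∀ t ∈ U, HasDerivAt (fun t => u t ^ q) (v t * q * u t ^ (q - 1)) t := by
    intro q t ht
    exact (hu t).rpow_const (Or.inl (ne_of_gt ht))
  have s0 : ∀ t ∈ U, iteratedDeriv 0 (fun t => u t ^ p) t = u t ^ p := by intro t _; simp
  have s1 := mb_iter_step U hU _ _ _ 0 s0 (hw p)
  have s2 := mb_iter_step U hU _ _ _ 1 s1 (fun t ht =>
    ((hv t).mul_const p).mul (hw (p - 1) t ht))
  have s3 := mb_iter_step U hU _ _ _ 2 s2 (fun t ht =>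
    ((hw (p - 1) t ht).const_mul (2 * a * p)).add
     (((hv t).mul_const p).mul (((hv t).mul_const (p - 1)).mul (hw (p - 1 - 1) t ht))))
  have s4 := mb_iter_step U hU _ _ _ 3 s3 (fun t ht =>
    ((((hv t).mul_const (p - 1)).mul (hw (p - 1 - 1) t ht)).const_mul (2 * a * p)).add
     (((((hv t).mul_const (p - 1)).mul (hw (p - 1 - 1) t ht)).const_mul (2 * a * p)).add
      (((hv t).mul_const p).mul (((hw (p - 1 - 1) t ht).const_mul (2 * a * (p - 1))).add
        (((hv t).mul_const (p - 1)).mul (((hv t).mul_const (p - 1 - 1)).mul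
          (hw (p - 1 - 1 - 1) t ht)))))))
  have h9 : u 0 = 9 := by simp [u]
  have h0 : v 0 = 2 * b := by simp [v]
  have := s4 0 (by change 0 < u 0; rw [h9]; norm_num)
  change iteratedDeriv 4 (fun t => u t ^ p) 0 = _
  refine this.trans ?_
  simp only [h9, h0, Real.rpow_sub_one (show (9:ℝ) ≠ 0 by norm_num)]
  ring

lemma mb_fderiv4 (d : ℕ) (x y : EuclideanSpace ℝ (Fin d)) (hx : ‖x‖ = 3) (p : ℝ)
    (hp : p = ((2:ℝ) - d) / 2) :
    iteratedFDeriv ℝ 4 (fun x : EuclideanSpace ℝ (Fin d) => ‖x‖ ^ ((2 : ℝ) - d)) x (fun _ => y) =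
    24 * (9 : ℝ) ^ p * (p * (p - 1) / 2 * (‖y‖ ^ 2) ^ 2 / 81 +
      p * (p - 1) * (p - 2) / 6 * (12 * (‖y‖ ^ 2) * (inner ℝ x y) ^ 2) / 729 +
       p * (p - 1) * (p - 2) * (p - 3) / 24 * (16 * (inner ℝ x y) ^ 4) / 6561) := by
  rw [← mb_iter4]
  set h : EuclideanSpace ℝ (Fin d) → ℝ := fun x => ‖x‖ ^ ((2 : ℝ) - d) with hh
  let f : EuclideanSpace ℝ (Fin d) → ℝ := fun v => h (x + v)
  let g : ℝ →L[ℝ] EuclideanSpace ℝ (Fin d) := ContinuousLinearMap.toSpanSingleton ℝ y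
  have hfg : (fun t : ℝ => (9 + 2 * inner ℝ x y * t + ‖y‖ ^ 2 * t ^ 2) ^ p) = f ∘ g := by
    ext t
    simp only [Function.comp, f, g, ContinuousLinearMap.toSpanSingleton_apply, hh]
    rw [mb_normpow d x y hx t, hp]
  have hs : IsOpen (ball (0 : EuclideanSpace ℝ (Fin d)) 1) := isOpen_ball
  have hs' : IsOpen (g ⁻¹' ball (0 : EuclideanSpace ℝ (Fin d)) 1) := hs.preimage g.continuous
  have hcd : ContDiffOn ℝ 4 f (ball 0 1) := by
    intro v hv
    have hne : x + v ≠ 0 := by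
      intro h0
      have : x = -v := eq_neg_of_add_eq_zero_left h0
      have h1 : ‖v‖ = 3 := by rw [← hx, this, norm_neg]
      have h2 : ‖v‖ < 1 := by simpa using hv
      linarith
    apply ContDiffAt.contDiffWithinAt
    apply ContDiffAt.rpow_const_of_ne
    · exact (contDiffAt_const.add contDiffAt_id).norm ℝ hne
    · exact norm_ne_zero_iff.2 hne
  have key := g.iteratedFDerivWithin_comp_right hcd hs.uniqueDiffOn hs'.uniqueDiffOn
    (x := 0) (by simp) (i := 4) le_rfl
  rw [iteratedFDerivWithin_of_isOpen 4 hs' (by simp), iteratedFDerivWithin_of_isOpen 4 hs (by simp)] at key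
  rw [hfg, iteratedDeriv_eq_iteratedFDeriv, key]
  simp only [f]
  rw [iteratedFDeriv_comp_add_left]
  simp [g]

lemma mb_sum4 {d : ℕ} (m : ContinuousMultilinearMap ℝ (fun _ : Fin 4 => EuclideanSpace ℝ (Fin d)) ℝ)
    (y : EuclideanSpace ℝ (Fin d)) :
    m (fun _ => y) = ∑ i, ∑ j, ∑ k, ∑ l, m ![EuclideanSpace.single i 1, EuclideanSpace.single j 1,
            EuclideanSpace.single k 1, EuclideanSpace.single l 1] * (y i * y j * y k * y l) := by
  have hy : y = ∑ i, y i • EuclideanSpace.single i (1:ℝ) := by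
    ext j
    simp [Finset.sum_apply, Pi.single_apply]
  have hcons : ∀ (n : ℕ) (F : (Fin (n + 1) → Fin d) → ℝ), ∑ r, F r = ∑ i, ∑ r : Fin n → Fin d,
      F (Matrix.vecCons i r) := by
    intro n F
    rw [← (Fin.consEquiv (fun _ => Fin d)).sum_comp, Fintype.sum_prod_type]
    rfl
  conv_lhs => rw [hy]
  rw [m.map_sum]
  simp_rw [hcons]
  refine Finset.sum_congr rfl fun i _ => Finset.sum_congr rfl fun j _ => Finset.sum_congr rfl fun k _ =>
    Finset.sum_congr rfl fun l _ => ?_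
  rw [Fintype.sum_unique, m.map_smul_univ, Fin.prod_univ_four, smul_eq_mul, mul_comm]
  congr 2
  ext q
  fin_cases q <;> rfl

lemma mb_odd {d : ℕ} (K : Set (EuclideanSpace ℝ (Fin d))) (hKsymm : K = -K)
    (g : EuclideanSpace ℝ (Fin d) → ℝ) (hg : ∀ y, g (-y) = - g y) (hK : MeasurableSet K) :
    ∫ y in K, g y = 0 := by
  have h1 : ∫ y in K, g y = - ∫ y in K, g y := by
    rw [← integral_indicator hK]
    conv_lhs => rw [← integral_neg_eq_self]
    rw [← integral_neg]
    congr 1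
    ext y
    have : -y ∈ K ↔ y ∈ K := by
      conv_lhs => rw [hKsymm]
      simp
    by_cases hy : y ∈ K
    · rw [Set.indicator_of_mem (this.2 hy), Set.indicator_of_mem hy, hg]
    · rw [Set.indicator_of_notMem (fun h => hy (this.1 h)), Set.indicator_of_notMem hy]; simp
  linarith

lemma mb_W (d : ℕ) (x y : EuclideanSpace ℝ (Fin d)) (hx : ‖x‖ = 3) (p : ℝ)
    (hp : p = ((2:ℝ) - d) / 2) :
    (p * (p - 1) / 2 * (‖y‖ ^ 2) ^ 2 / 81 +
      p * (p - 1) * (p - 2) / 6 * (12 * (‖y‖ ^ 2) * (inner ℝ x y) ^ 2) / 729 +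
       p * (p - 1) * (p - 2) * (p - 3) / 24 * (16 * (inner ℝ x y) ^ 4) / 6561) =
    p * (p - 1) / 39366 * mbq x y := by
  unfold mbq
  rw [hx, hp]; ring

lemma mb_second {d : ℕ} (K : Set (EuclideanSpace ℝ (Fin d))) (hK : IsCompact K)
    (hKnorm : ∀ i j : Fin d, (∫ y in K, y i * y j) = if i = j then (1 : ℝ) else 0)
    (x : EuclideanSpace ℝ (Fin d)) :
    (∫ y in K, ‖y‖ ^ 2 = d) ∧ ∫ y in K, (inner ℝ x y) ^ 2 = ‖x‖ ^ 2 := by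
  have hI : ∀ f : EuclideanSpace ℝ (Fin d) → ℝ, Continuous f → IntegrableOn f K := fun f hf =>
    hf.continuousOn.integrableOn_compact hK
  constructor
  · simp_rw [EuclideanSpace.real_norm_sq_eq]
    rw [integral_finsetSum _ (fun j _ => hI _ (by fun_prop))]
    have : ∀ i : Fin d, ∫ y in K, (y i) ^ 2 = 1 := by
      intro i
      have := hKnorm i i
      simp only [if_true] at this
      rw [← this]; congr 1; ext y; ring
    simp [this]
  · have e : ∀ y : EuclideanSpace ℝ (Fin d), (inner ℝ x y) ^ 2 =
        ∑ i, ∑ j, (x i * x j) * (y i * y j) := by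
      intro y
      rw [PiLp.inner_apply, sq, Finset.sum_mul_sum]
      refine Finset.sum_congr rfl fun i _ => Finset.sum_congr rfl fun j _ => ?_
      simp; ring
    simp_rw [e]
    rw [integral_finsetSum _ (fun j _ => hI _ (by fun_prop))]
    have : ∀ i : Fin d, ∫ y in K, ∑ j, (x i * x j) * (y i * y j) = x i ^ 2 := by
      intro i
      rw [integral_finsetSum _ (fun j _ => hI _ (by fun_prop))]
      simp_rw [integral_const_mul, hKnorm]
      simp; ring
    simp_rw [this]
    rw [EuclideanSpace.real_norm_sq_eq]

set_option maxHeartbeats 1000000 in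
lemma mb_int_expand (d : ℕ) (K : Set (EuclideanSpace ℝ (Fin d))) (hK : IsCompact K)
    (hKsymm : K = -K)
    (hKnorm : ∀ i j : Fin d, (∫ y in K, y i * y j) = if i = j then (1 : ℝ) else 0)
    (x : EuclideanSpace ℝ (Fin d)) (hx : ‖x‖ = 3) (p : ℝ) (hp : p = ((2:ℝ) - d) / 2) :
    ∃ C > 0, ∃ δ > 0, ∀ t : ℝ, 0 < t → t < δ →
      |(∫ y in K, ‖x + t • y‖ ^ ((2 : ℝ) - d)) - (9 : ℝ) ^ p * (volume.real K +
        t ^ 4 * (p * (p - 1) / 39366 * ∫ y in K, mbq x y))| ≤ C * t ^ 5 := by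
  obtain ⟨R0, hR0, hR⟩ := hK.isBounded.exists_pos_norm_le
  obtain ⟨C, hC, δ, hδ, H⟩ := mb_expand p (R0 ^ 2 + 3 * R0)
  refine ⟨C * (volume.real K + 1), by positivity, min δ (1 / R0), by positivity, fun t ht htd => ?_⟩
  have htδ : t < δ := lt_of_lt_of_le htd (min_le_left _ _)
  have htR : t * R0 < 1 := by
    have := lt_of_lt_of_le htd (min_le_right _ _)
    rwa [lt_div_iff₀ hR0] at this
  have hI : ∀ f : EuclideanSpace ℝ (Fin d) → ℝ, Continuous f → IntegrableOn f K := fun f hf =>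
    hf.continuousOn.integrableOn_compact hK
  let P : EuclideanSpace ℝ (Fin d) → ℝ := fun y => (9 : ℝ) ^ p * (1 + (p * (2 * inner ℝ x y) / 9) * t +
      (p * ‖y‖ ^ 2 / 9 + p * (p - 1) / 2 * (4 * inner ℝ x y ^ 2) / 81) * t ^ 2 +
      (p * (p - 1) / 2 * (4 * ‖y‖ ^ 2 * inner ℝ x y) / 81 + p * (p - 1) * (p - 2) / 6 * (8 * inner ℝ x y ^ 3) / 729) * t ^ 3 +
      (p * (p - 1) / 2 * (‖y‖ ^ 2) ^ 2 / 81 + p * (p - 1) * (p - 2) / 6 * (12 * ‖y‖ ^ 2 * inner ℝ x y ^ 2) / 729 +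
       p * (p - 1) * (p - 2) * (p - 3) / 24 * (16 * inner ℝ x y ^ 4) / 6561) * t ^ 4)
  have hP : Continuous P := by fun_prop
  have hFP : ∀ y ∈ K, ‖‖x + t • y‖ ^ ((2 : ℝ) - d) - P y‖ ≤ C * t ^ 5 := by
    intro y hy
    rw [mb_normpow d x y hx t, ← hp]
    have hyR := hR y hy
    apply H _ _ t _ _ ht htδ
    · rw [abs_of_nonneg (by positivity)]
      nlinarith [norm_nonneg y]
    · refine (abs_real_inner_le_norm x y).trans ?_
      rw [hx]; nlinarith [norm_nonneg y]
  have hF : IntegrableOn (fun y => ‖x + t • y‖ ^ ((2 : ℝ) - d)) K := by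
    apply ContinuousOn.integrableOn_compact hK
    apply ContinuousOn.rpow_const (by fun_prop)
    intro y hy
    left
    rw [norm_ne_zero_iff]
    intro h0
    have h1 : x = -(t • y) := eq_neg_of_add_eq_zero_left h0
    have h2 : ‖x‖ = t * ‖y‖ := by rw [h1, norm_neg, norm_smul, Real.norm_of_nonneg ht.le]
    have := mul_le_mul_of_nonneg_left (hR y hy) ht.le
    linarith
  have hPint : ∫ y in K, P y = (9 : ℝ) ^ p * (volume.real K +
        t ^ 4 * (p * (p - 1) / 39366 * ∫ y in K, mbq x y)) := by
    have hmq : Continuous fun y => mbq x y := by unfold mbq; fun_prop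
    let O : EuclideanSpace ℝ (Fin d) → ℝ := fun y => (p * (2 * inner ℝ x y) / 9) * t +
      (p * (p - 1) / 2 * (4 * ‖y‖ ^ 2 * inner ℝ x y) / 81 + p * (p - 1) * (p - 2) / 6 * (8 * inner ℝ x y ^ 3) / 729) * t ^ 3
    have hO : Continuous O := by fun_prop
    have hO0 : ∫ y in K, O y = 0 := by
      apply mb_odd K hKsymm _ _ hK.measurableSet
      intro y
      simp only [O, inner_neg_right, norm_neg]
      ring
    have e : ∀ y, P y = (9 : ℝ) ^ p * (1 + O y + (p / 9 * t ^ 2) * ‖y‖ ^ 2 +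
        (p * (p - 1) / 2 * 4 / 81 * t ^ 2) * inner ℝ x y ^ 2 +
        (t ^ 4 * (p * (p - 1) / 39366)) * mbq x y) := by
      intro y
      simp only [P, O]
      rw [mb_W d x y hx p hp]
      ring
    simp_rw [e]
    rw [integral_const_mul, integral_add (hI _ (by fun_prop)) (hI _ (by fun_prop)),
      integral_add (hI _ (by fun_prop)) (hI _ (by fun_prop)),
      integral_add (hI _ (by fun_prop)) (hI _ (by fun_prop)),
      integral_add (hI _ (by fun_prop)) (hI _ (by fun_prop)), hO0,
      integral_const_mul, integral_const_mul, integral_const_mul,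
      (mb_second K hK hKnorm x).1, (mb_second K hK hKnorm x).2, hx]
    simp only [integral_const, measureReal_restrict_apply_univ, smul_eq_mul, mul_one]
    have : (p / 9 * t ^ 2) * d + (p * (p - 1) / 2 * 4 / 81 * t ^ 2) * 3 ^ 2 = 0 := by
      rw [hp]; ring
    linear_combination (9:ℝ) ^ p * this
  rw [← hPint, ← integral_sub hF (hI _ hP)]
  refine (norm_setIntegral_le_of_norm_le_const hK.measure_lt_top hFP).trans ?_
  have : 0 < C * t ^ 5 := by positivity
  nlinarith


theorem maximal_beats_h_somewhere_on_sphere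
    (d : ℕ) (hd : 3 ≤ d)
    (K : Set (EuclideanSpace ℝ (Fin d))) (hKcomp : IsCompact K) (hKconv : Convex ℝ K)
    (hKint : (interior K).Nonempty) (hKsymm : K = -K)
    (hKnorm : ∀ i j : Fin d, (∫ y in K, y i * y j) = if i = j then (1 : ℝ) else 0)
    (h : EuclideanSpace ℝ (Fin d) → ℝ)
    (hh : h = fun x => ‖x‖ ^ ((2 : ℝ) - d))
    (pt : EuclideanSpace ℝ (Fin d))
    (hpt : pt = EuclideanSpace.single (⟨0, by omega⟩ : Fin d) (3 : ℝ))
    (hcond : (∑ i, ∑ j, ∑ k, ∑ l,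
        (iteratedFDeriv ℝ 4 h pt
          ![EuclideanSpace.single i 1, EuclideanSpace.single j 1,
            EuclideanSpace.single k 1, EuclideanSpace.single l 1])
          * ∫ y in K, y i * y j * y k * y l) ≠ 0) :
    ∃ z : EuclideanSpace ℝ (Fin d), ‖z‖ = 1 ∧
      (3 : ℝ) ^ ((2 : ℝ) - d) < centeredMax K h ((3 : ℝ) • z) ∧
      h ((3 : ℝ) • z) = (3 : ℝ) ^ ((2 : ℝ) - d) := by
  have hI : ∀ f : EuclideanSpace ℝ (Fin d) → ℝ, Continuous f → IntegrableOn f K := fun f hf =>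
    hf.continuousOn.integrableOn_compact hKcomp
  have hV : 0 < volume.real K := by
    refine ENNReal.toReal_pos ?_ hKcomp.measure_lt_top.ne
    exact (Measure.measure_pos_of_nonempty_interior volume hKint).ne'
  have hptn : ‖pt‖ = 3 := by rw [hpt]; simp
  set p : ℝ := ((2:ℝ) - d) / 2 with hp
  have hd3 : (3:ℝ) ≤ d := by exact_mod_cast hd
  have hκ : 0 < p * (p - 1) := by
    have : p < 0 := by rw [hp]; linarith
    nlinarith
  have hne : ∫ y in K, mbq pt y ≠ 0 := by
    intro h0
    apply hcond
    have e1 : (∑ i, ∑ j, ∑ k, ∑ l,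
        (iteratedFDeriv ℝ 4 h pt
          ![EuclideanSpace.single i 1, EuclideanSpace.single j 1,
            EuclideanSpace.single k 1, EuclideanSpace.single l 1])
          * ∫ y in K, y i * y j * y k * y l) = ∫ y in K, iteratedFDeriv ℝ 4 h pt (fun _ => y) := by
      simp_rw [mb_sum4 (iteratedFDeriv ℝ 4 h pt)]
      rw [integral_finsetSum _ (fun j _ => hI _ (by fun_prop))]
      refine Finset.sum_congr rfl fun i _ => ?_
      rw [integral_finsetSum _ (fun j _ => hI _ (by fun_prop))]
      refine Finset.sum_congr rfl fun j _ => ?_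
      rw [integral_finsetSum _ (fun j _ => hI _ (by fun_prop))]
      refine Finset.sum_congr rfl fun k _ => ?_
      rw [integral_finsetSum _ (fun j _ => hI _ (by fun_prop))]
      refine Finset.sum_congr rfl fun l _ => ?_
      rw [integral_const_mul]
    rw [e1, hh]
    simp_rw [mb_fderiv4 d pt _ hptn p hp, mb_W d pt _ hptn p hp]
    rw [integral_const_mul, integral_const_mul, h0]; simp
  obtain ⟨z, hz, hpos⟩ := mbQ_exists (⟨0, by omega⟩ : Fin d) K hKcomp pt hptn hne
  have hx : ‖(3:ℝ) • z‖ = 3 := by rw [norm_smul, hz]; norm_num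
  set x := (3:ℝ) • z with hxdef
  refine ⟨z, hz, ?_, by rw [hh]; simp only [← hxdef, hx]⟩
  obtain ⟨C, hC, δ, hδ, H⟩ := mb_int_expand d K hKcomp hKsymm hKnorm x hx p hp
  set w := (9:ℝ) ^ p * (p * (p - 1) / 39366 * ∫ y in K, mbq x y) with hw
  have hwpos : 0 < w := by positivity
  set t := min (δ / 2) (w / (2 * C)) with ht
  have htpos : 0 < t := by positivity
  have h1 := H t htpos (lt_of_le_of_lt (min_le_left _ _) (by linarith))
  have h2 : C * t < w := by
    have : t ≤ w / (2 * C) := min_le_right _ _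
    rw [le_div_iff₀ (by positivity)] at this
    nlinarith
  have h3 : (9:ℝ) ^ p * volume.real K < ∫ y in K, ‖x + t • y‖ ^ ((2 : ℝ) - d) := by
    have h4 := (abs_le.1 h1).1
    have h5 : C * t ^ 5 < t ^ 4 * w := by
      have : 0 < t ^ 4 := by positivity
      nlinarith
    rw [hw] at h5
    nlinarith
  have h9 : (9:ℝ) ^ p = (3:ℝ) ^ ((2:ℝ) - d) := by
    rw [show (9:ℝ) = 3 ^ (2:ℝ) by norm_num, ← Real.rpow_mul (by norm_num)]
    congr 1; rw [hp]; ring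
  have havg := mb_avg K hKcomp.measurableSet (fun y => |‖y‖ ^ ((2 : ℝ) - d)|) x t htpos
  have h6 : (3:ℝ) ^ ((2:ℝ) - d) < ⨍ y in (fun z => x + t • z) '' K, |‖y‖ ^ ((2 : ℝ) - d)| := by
    rw [havg, ← h9, ← div_eq_inv_mul, lt_div_iff₀ hV]
    simp only [abs_of_nonneg (Real.rpow_nonneg (norm_nonneg _) _)]
    exact h3
  unfold centeredMax
  rw [hh]
  exact lt_of_lt_of_le h6 (le_ciSup (mb_bdd d hd K hKcomp hV x hx) (⟨t, htpos⟩ : {l : ℝ // 0 < l}))
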